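/- Let k be a field of characteristic zero and let (R, Δ_R) and (S, Δ_S) be commutative differential k-algebras with R and S noetherian and dim_k R, dim_k S, |Δ_R|, |Δ_S| all strictly less than |k|. If there is an inclusion-preserving bijection (an order isomorphism) between the posets (Δ_R-spec R, ⊆) and (Δ_S-spec S, ⊆), then R satisfies the Δ_R-Dixmier-Moeglin equivalence if and only if S satisfies the Δ_S-Dixmier-Moeglin equivalence. In particular this holds if Δ_R-spec R and Δ_S-spec S are homeomorphic. -/

import Mathlib

universe u

section DifferentialAlgebra

variable (k R : Type u) [Field k] [CommRing R] [Algebra k R]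

/-- `I` is a `Δ`-ideal: it is stable under every derivation in `Δ`. -/
def IsDeltaIdeal (Δ : Set (Derivation k R R)) (I : Ideal R) : Prop :=
  ∀ δ ∈ Δ, ∀ x ∈ I, δ x ∈ I

/-- `P` is a `Δ`-prime ideal: a prime ideal which is a `Δ`-ideal. -/
def IsDeltaPrime (Δ : Set (Derivation k R R)) (P : Ideal R) : Prop :=
  P.IsPrime ∧ IsDeltaIdeal k R Δ P

/-- The `Δ`-core of an ideal `J`: the largest `Δ`-ideal contained in `J`. -/
def deltaCore (Δ : Set (Derivation k R R)) (J : Ideal R) : Ideal R :=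
  sSup {I : Ideal R | IsDeltaIdeal k R Δ I ∧ I ≤ J}

/-- `P` is `Δ`-primitive: it is the `Δ`-core of some maximal ideal. -/
def IsDeltaPrimitive (Δ : Set (Derivation k R R)) (P : Ideal R) : Prop :=
  ∃ M : Ideal R, M.IsMaximal ∧ deltaCore k R Δ M = P

/-- `Δ`-spec `R`: the set of `Δ`-prime ideals, topologized as a subspace of `Spec R`. -/
abbrev DeltaSpec (Δ : Set (Derivation k R R)) : Type u :=
  {P : PrimeSpectrum R // IsDeltaIdeal k R Δ P.asIdeal}

/-- `P` is `Δ`-rational: whenever `a, b ∈ R` with `b ∉ P` are such that the class of `a/b` in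
`Frac(R/P)` is killed by all the induced derivations, that class is algebraic over `k`. -/
def IsDeltaRational (Δ : Set (Derivation k R R)) (P : Ideal R) (hP : P.IsPrime) : Prop :=
  haveI := hP
  ∀ a b : R, b ∉ P → (∀ δ ∈ Δ, δ a * b - a * δ b ∈ P) →
    IsAlgebraic k
      (algebraMap (R ⧸ P) (FractionRing (R ⧸ P)) (Ideal.Quotient.mk P a) /
       algebraMap (R ⧸ P) (FractionRing (R ⧸ P)) (Ideal.Quotient.mk P b))

/-- `P` is `κ`-separable in `Δ`-spec `R`: there is a set `Λ`, of cardinality `< κ`, of `Δ`-prime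
ideals properly containing `P`, such that every `Δ`-prime ideal properly containing `P` contains
a member of `Λ`. -/
def DeltaSeparable (Δ : Set (Derivation k R R)) (κ : Cardinal.{u}) (P : Ideal R) : Prop :=
  ∃ Λ : Set (Ideal R), (∀ Q ∈ Λ, IsDeltaPrime k R Δ Q ∧ P < Q) ∧
    Cardinal.mk Λ < κ ∧
    ∀ Q : Ideal R, IsDeltaPrime k R Δ Q → P < Q → ∃ Q' ∈ Λ, Q' ≤ Q

/-- `R` satisfies the `Δ`-Dixmier–Moeglin equivalence: for every `Δ`-prime ideal `P`, the
conditions "`{P}` is locally closed in `Δ`-spec `R`", "`P` is `Δ`-primitive", and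
"`P` is `Δ`-rational" are equivalent. -/
def DeltaDME (Δ : Set (Derivation k R R)) : Prop :=
  ∀ (P : PrimeSpectrum R) (hP : IsDeltaIdeal k R Δ P.asIdeal),
    (IsLocallyClosed ({⟨P, hP⟩} : Set (DeltaSpec k R Δ)) ↔ IsDeltaPrimitive k R Δ P.asIdeal) ∧
    (IsDeltaPrimitive k R Δ P.asIdeal ↔ IsDeltaRational k R Δ P.asIdeal P.isPrime)

end DifferentialAlgebra

section DifferentialIdeals

variable {k R : Type u} [Field k] [CommRing R] [Algebra k R] {Δ : Set (Derivation k R R)}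

theorem IsDeltaIdeal.sSup {F : Set (Ideal R)} (h : ∀ I ∈ F, IsDeltaIdeal k R Δ I) :
    IsDeltaIdeal k R Δ (sSup F) := by
  intro δ hδ x hx
  rw [sSup_eq_iSup'] at hx ⊢
  induction hx using Submodule.iSup_induction' with
  | mem I x hx => exact Submodule.mem_iSup_of_mem I (h I.1 I.2 δ hδ x hx)
  | zero => simp
  | add x y _ _ hx hy => rw [map_add]; exact add_mem hx hy

theorem IsDeltaIdeal.sInf {F : Set (Ideal R)} (h : ∀ I ∈ F, IsDeltaIdeal k R Δ I) :
    IsDeltaIdeal k R Δ (sInf F) := by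
  intro δ hδ x hx
  rw [Submodule.mem_sInf] at hx ⊢
  exact fun I hI => h I hI δ hδ x (hx I hI)

theorem deltaCore_isDeltaIdeal (J : Ideal R) : IsDeltaIdeal k R Δ (deltaCore k R Δ J) :=
  IsDeltaIdeal.sSup fun _ hI => hI.1

theorem deltaCore_le (J : Ideal R) : deltaCore k R Δ J ≤ J :=
  sSup_le fun _ hI => hI.2

theorem le_deltaCore {I J : Ideal R} (hI : IsDeltaIdeal k R Δ I) (h : I ≤ J) :
    I ≤ deltaCore k R Δ J :=
  le_sSup ⟨hI, h⟩

theorem IsDeltaIdeal.colon_singleton {I : Ideal R} (hI : IsDeltaIdeal k R Δ I)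
    (hrad : I.IsRadical) (b : R) :
    IsDeltaIdeal k R Δ ((I.restrictScalars R).comap (LinearMap.mulLeft R b)) := by
  intro δ hδ a ha
  have ha : b * a ∈ I := ha
  change b * δ a ∈ I
  refine hrad ⟨2, ?_⟩
  have h1 := I.mul_mem_left (b * δ a) (hI δ hδ _ ha)
  have h2 := I.mul_mem_left (δ a * δ b) ha
  convert sub_mem h1 h2 using 1
  simp
  ring

/-- The `Δ`-prime ideals minimal over the `Δ`-ideal generated by `P` and `d`. -/
def deltaMinimalOver (Δ : Set (Derivation k R R)) (P : Ideal R) (d : R) : Set (Ideal R) :=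
  (sInf {I : Ideal R | IsDeltaIdeal k R Δ I ∧ P ≤ I ∧ d ∈ I}).minimalPrimes

theorem exists_deltaMinimalOver_le {P Q : Ideal R} {d : R} (hQ : IsDeltaPrime k R Δ Q)
    (hPQ : P ≤ Q) (hd : d ∈ Q) : ∃ Q' ∈ deltaMinimalOver Δ P d, Q' ≤ Q := by
  have := hQ.1
  exact Ideal.exists_minimalPrimes_le (sInf_le ⟨hQ.2, hPQ, hd⟩)

theorem deltaMinimalOver_finite [IsNoetherianRing R] (P : Ideal R) (d : R) :
    (deltaMinimalOver Δ P d).Finite :=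
  Ideal.finite_minimalPrimes_of_isNoetherianRing R _

variable [CharZero k]

theorem pow_derivation_mem {I : Ideal R} (hI : IsDeltaIdeal k R Δ I) {δ : Derivation k R R}
    (hδ : δ ∈ Δ) (x : R) (m j : ℕ) (h : x ^ m * δ x ^ (2 * j) ∈ I) :
    δ x ^ (2 * (j + m)) ∈ I := by
  induction m generalizing j with
  | zero => simpa using h
  | succ m ih =>
    have key : x ^ m * δ x ^ (2 * (j + 1)) ∈ I := by
      have h1 := hI δ hδ _ h
      have h2 : ((m + 1 : ℕ) : k) • (x ^ m * δ x ^ (2 * (j + 1))) ∈ I := by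
        have : ((m + 1 : ℕ) : k) • (x ^ m * δ x ^ (2 * (j + 1))) =
            δ x * δ (x ^ (m + 1) * δ x ^ (2 * j))
              - (2 * j * δ (δ x)) * (x ^ (m + 1) * δ x ^ (2 * j)) := by
          rw [Nat.cast_smul_eq_nsmul, nsmul_eq_mul]
          rcases j with _ | j
          · simp [Derivation.leibniz_pow]
            ring
          · simp [Derivation.leibniz_pow,
              show 2 * (j + 1) - 1 = 2 * j + 1 by omega]
            ring
        rw [this]
        exact sub_mem (I.mul_mem_left _ h1) (I.mul_mem_left _ h)
      have h3 := (I.restrictScalars k).smul_mem ((m + 1 : ℕ) : k)⁻¹ h2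
      rw [inv_smul_smul₀ (by exact_mod_cast m.succ_ne_zero)] at h3
      exact h3
    have := ih (j + 1) key
    rwa [show j + (m + 1) = j + 1 + m by omega]

theorem IsDeltaIdeal.radical {I : Ideal R} (hI : IsDeltaIdeal k R Δ I) :
    IsDeltaIdeal k R Δ I.radical := by
  rintro δ hδ x ⟨n, hn⟩
  exact ⟨_, pow_derivation_mem hI hδ x n 0 (by simpa using hn)⟩

theorem deltaCore_isPrime {Q : Ideal R} (hQ : Q.IsPrime) : (deltaCore k R Δ Q).IsPrime := by
  set I := deltaCore k R Δ Q with hIdef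
  have hI : IsDeltaIdeal k R Δ I := deltaCore_isDeltaIdeal Q
  have hIQ : I ≤ Q := deltaCore_le Q
  have hrad : I.IsRadical :=
    le_deltaCore hI.radical ((Ideal.radical_mono hIQ).trans hQ.isRadical)
  refine ⟨fun h => hQ.ne_top (top_le_iff.1 (h ▸ hIQ)), fun {a b} hab => ?_⟩
  by_contra! hcon
  have hb := hI.colon_singleton hrad b
  have hnot : ¬ (I.restrictScalars R).comap (LinearMap.mulLeft R b) ≤ Q := fun h =>
    hcon.1 (le_deltaCore hb h (show b * a ∈ I by rwa [mul_comm]))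
  obtain ⟨x, hx, hxQ⟩ := SetLike.not_le_iff_exists.1 hnot
  have hx : b * x ∈ I := hx
  have hx' := hI.colon_singleton hrad x
  refine hcon.2 (le_deltaCore hx' (fun y hy => ?_) (show x * b ∈ I by rwa [mul_comm]))
  exact (hQ.mem_or_mem (hIQ (show x * y ∈ I from hy))).resolve_left hxQ

theorem IsDeltaIdeal.isDeltaPrime_of_mem_minimalPrimes {I Q : Ideal R}
    (hI : IsDeltaIdeal k R Δ I) (hQ : Q ∈ I.minimalPrimes) : IsDeltaPrime k R Δ Q := by
  refine ⟨hQ.1.1, ?_⟩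
  have h : Q ≤ deltaCore k R Δ Q :=
    hQ.2 ⟨deltaCore_isPrime hQ.1.1, le_deltaCore hI hQ.1.2⟩ (deltaCore_le Q)
  rw [le_antisymm h (deltaCore_le Q)]
  exact deltaCore_isDeltaIdeal Q

theorem deltaMinimalOver_spec {P : Ideal R} {d : R} (hd : d ∉ P) :
    ∀ Q ∈ deltaMinimalOver Δ P d, IsDeltaPrime k R Δ Q ∧ P < Q := by
  intro Q hQ
  have hJ : IsDeltaIdeal k R Δ (sInf {I : Ideal R | IsDeltaIdeal k R Δ I ∧ P ≤ I ∧ d ∈ I}) :=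
    IsDeltaIdeal.sInf fun I hI => hI.1
  refine ⟨hJ.isDeltaPrime_of_mem_minimalPrimes hQ,
    lt_of_le_of_ne ((le_sInf fun I hI => hI.2.1).trans hQ.1.2) ?_⟩
  rintro rfl
  exact hd (hQ.1.2 (Submodule.mem_sInf.2 fun I hI => hI.2.2))

/-- For a `Δ`-prime ideal, being locally closed means being `ℵ₀`-separable. -/
theorem isLocallyClosed_iff_deltaSeparable [IsNoetherianRing R] (P : PrimeSpectrum R)
    (hP : IsDeltaIdeal k R Δ P.asIdeal) :
    IsLocallyClosed ({⟨P, hP⟩} : Set (DeltaSpec k R Δ)) ↔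
      DeltaSeparable k R Δ Cardinal.aleph0 P.asIdeal := by
  constructor
  · rintro ⟨U, Z, hU, hZ, hUZ⟩
    obtain ⟨V, hV, rfl⟩ := isOpen_induced_iff.1 hU
    obtain ⟨hPV, hPZ⟩ : (⟨P, hP⟩ : DeltaSpec k R Δ) ∈ Subtype.val ⁻¹' V ∩ Z := hUZ ▸ rfl
    obtain ⟨s, hs⟩ := (PrimeSpectrum.isClosed_iff_zeroLocus _).1 hV.isClosed_compl
    have hPs : ¬ s ⊆ P.asIdeal := by
      intro h
      have : P ∈ Vᶜ := hs ▸ h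
      exact this hPV
    obtain ⟨f, hfs, hfP⟩ := Set.not_subset.1 hPs
    refine ⟨deltaMinimalOver Δ P.asIdeal f, deltaMinimalOver_spec hfP,
      (deltaMinimalOver_finite _ _).lt_aleph0, fun Q hQ hPQ => ?_⟩
    refine exists_deltaMinimalOver_le hQ hPQ.le ?_
    let Q' : DeltaSpec k R Δ := ⟨⟨Q, hQ.1⟩, hQ.2⟩
    have hspec : (⟨P, hP⟩ : DeltaSpec k R Δ) ⤳ Q' :=
      (subtype_specializes_iff _ _).2 ((PrimeSpectrum.le_iff_specializes _ _).1 hPQ.le)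
    have hQZ : Q' ∈ Z := hspec.mem_closed hZ hPZ
    have hQV : Q'.1 ∈ Vᶜ := by
      intro h
      have : Q' ∈ ({⟨P, hP⟩} : Set (DeltaSpec k R Δ)) := hUZ ▸ ⟨h, hQZ⟩
      exact hPQ.ne' (congrArg (fun x : DeltaSpec k R Δ => x.1.asIdeal) this)
    rw [hs] at hQV
    exact hQV hfs
  · rintro ⟨Λ, hΛ, hfin, hsep⟩
    have hfin : Λ.Finite := Cardinal.lt_aleph0_iff_set_finite.1 hfin
    have hch : ∀ Q : Λ, ∃ f ∈ Q.1, f ∉ P.asIdeal := fun Q =>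
      (SetLike.lt_iff_le_and_exists.1 (hΛ Q.1 Q.2).2).2
    choose f hfQ hfP using hch
    have := hfin.fintype
    refine ⟨Subtype.val ⁻¹' (PrimeSpectrum.basicOpen (∏ Q, f Q) : Set (PrimeSpectrum R)),
      Subtype.val ⁻¹' (PrimeSpectrum.zeroLocus P.asIdeal),
      (PrimeSpectrum.basicOpen _).isOpen.preimage continuous_subtype_val,
      (PrimeSpectrum.isClosed_zeroLocus _).preimage continuous_subtype_val, ?_⟩
    ext Q
    simp only [Set.mem_singleton_iff, Set.mem_inter_iff, Set.mem_preimage, SetLike.mem_coe,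
      PrimeSpectrum.mem_basicOpen, PrimeSpectrum.mem_zeroLocus, SetLike.coe_subset_coe]
    constructor
    · rintro rfl
      refine ⟨fun h => ?_, le_rfl⟩
      obtain ⟨Q, -, hQ⟩ := (P.isPrime.prod_mem_iff).1 h
      exact hfP Q hQ
    · rintro ⟨hf, hle⟩
      by_contra hne
      have hlt : P.asIdeal < Q.1.asIdeal := lt_of_le_of_ne hle fun h =>
        hne (Subtype.ext (PrimeSpectrum.ext h.symm))
      obtain ⟨Q', hQ', hle'⟩ := hsep _ ⟨Q.1.isPrime, Q.2⟩ hlt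
      exact hf (Ideal.mem_of_dvd _ (Finset.dvd_prod_of_mem f (Finset.mem_univ ⟨Q', hQ'⟩))
        (hle' (hfQ ⟨Q', hQ'⟩)))

end DifferentialIdeals

section HomogeneousEval

open Polynomial

variable {k R K : Type*} [Field k] [CommRing R] [Algebra k R] [Field K] [Algebra k K]

/-- The value `∑ fᵢ sⁱ r ^ (n - i)` at `(s, r)` of the homogenization of `f`, where `n` is the
degree of `f`. -/
noncomputable def homogeneousEval (f : k[X]) (s r : R) : R :=
  ∑ i ∈ Finset.range (f.natDegree + 1), f.coeff i • (s ^ i * r ^ (f.natDegree - i))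

theorem map_homogeneousEval (φ : R →ₐ[k] K) (f : k[X]) (s : R) {r : R} (hr : φ r ≠ 0) :
    φ (homogeneousEval f s r) = φ r ^ f.natDegree * aeval (φ s / φ r) f := by
  rw [homogeneousEval, map_sum, aeval_eq_sum_range, Finset.mul_sum]
  refine Finset.sum_congr rfl fun i hi => ?_
  have hi : i ≤ f.natDegree := Nat.lt_succ_iff.1 (Finset.mem_range.1 hi)
  rw [map_smul, map_mul, map_pow, map_pow, mul_smul_comm, div_pow, pow_sub₀ _ hr hi]
  congr 1
  field_simp

theorem mem_of_homogeneousEval_mem {Q : Ideal R} (hQ : Q.IsPrime) {f : k[X]}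
    (hf : f.coeff 0 ≠ 0) {s r : R} (h : homogeneousEval f s r ∈ Q) (hs : s ∈ Q) : r ∈ Q := by
  rw [homogeneousEval, Finset.sum_range_succ'] at h
  have h1 : ∑ i ∈ Finset.range f.natDegree,
      f.coeff (i + 1) • (s ^ (i + 1) * r ^ (f.natDegree - (i + 1))) ∈ Q :=
    sum_mem fun i _ => (Q.restrictScalars k).smul_mem _
      (Q.mul_mem_right _ (Q.pow_mem_of_mem hs _ i.succ_pos))
  have h2 := (Q.restrictScalars k).smul_mem (f.coeff 0)⁻¹ ((Q.add_mem_iff_right h1).1 h)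
  rw [inv_smul_smul₀ hf] at h2
  exact hQ.mem_of_pow_mem _ (by simpa using h2)

end HomogeneousEval

theorem isAlgebraic_of_rank_lt_mk {k K : Type u} [Field k] [Field K] [Algebra k K]
    (h : Module.rank k K < Cardinal.mk k) : Algebra.IsAlgebraic k K := by
  refine ⟨fun x => ?_⟩
  by_contra hx
  exact h.not_ge (Transcendental.linearIndependent_sub_inv hx).cardinal_le_rank

section DeltaConstants

variable {k R : Type u} [Field k] [CommRing R] [Algebra k R]

/-- The fraction `x / t` modulo `P` is killed by every derivation in `Δ`. -/
def IsDeltaConst (Δ : Set (Derivation k R R)) (P : Ideal R) (x t : R) : Prop :=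
  ∀ δ ∈ Δ, δ x * t - x * δ t ∈ P

variable {Δ : Set (Derivation k R R)} {P : Ideal R}

theorem IsDeltaConst.symm {x t : R} (h : IsDeltaConst Δ P x t) : IsDeltaConst Δ P t x := by
  intro δ hδ
  convert neg_mem (h δ hδ) using 1
  ring

theorem IsDeltaConst.refl (x : R) : IsDeltaConst Δ P x x := by
  intro δ _
  convert P.zero_mem using 1
  ring

theorem IsDeltaConst.mul {x t y u : R} (h : IsDeltaConst Δ P x t) (h' : IsDeltaConst Δ P y u) :
    IsDeltaConst Δ P (x * y) (t * u) := by
  intro δ hδ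
  convert add_mem (P.mul_mem_left (y * u) (h δ hδ)) (P.mul_mem_left (x * t) (h' δ hδ)) using 1
  simp
  ring

theorem IsDeltaConst.pow {x t : R} (h : IsDeltaConst Δ P x t) (n : ℕ) :
    IsDeltaConst Δ P (x ^ n) (t ^ n) := by
  induction n with
  | zero => simpa using IsDeltaConst.refl 1
  | succ n ih => simpa only [pow_succ] using ih.mul h

theorem IsDeltaConst.smul {x t : R} (h : IsDeltaConst Δ P x t) (c : k) :
    IsDeltaConst Δ P (c • x) t := by
  intro δ hδ
  convert (P.restrictScalars k).smul_mem c (h δ hδ) using 1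
  simp [smul_sub]

theorem IsDeltaConst.sum {ι : Type*} (s : Finset ι) {x : ι → R} {t : R}
    (h : ∀ i ∈ s, IsDeltaConst Δ P (x i) t) : IsDeltaConst Δ P (∑ i ∈ s, x i) t := by
  intro δ hδ
  rw [map_sum, Finset.sum_mul, Finset.sum_mul, ← Finset.sum_sub_distrib]
  exact sum_mem fun i hi => h i hi δ hδ

theorem IsDeltaConst.homogeneousEval {s r : R} (h : IsDeltaConst Δ P s r) (f : Polynomial k) :
    IsDeltaConst Δ P (homogeneousEval f s r) (r ^ f.natDegree) := by
  refine IsDeltaConst.sum _ fun i hi => IsDeltaConst.smul ?_ _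
  have hi : i ≤ f.natDegree := Nat.lt_succ_iff.1 (Finset.mem_range.1 hi)
  have := (h.pow i).mul (IsDeltaConst.refl (Δ := Δ) (P := P) (r ^ (f.natDegree - i)))
  rwa [← pow_add, Nat.add_sub_cancel' hi] at this

theorem IsDeltaConst.of_mul_sub_mul_mem (hP : P.IsPrime) (hPΔ : IsDeltaIdeal k R Δ P)
    {a b s r : R} (hb : b ∉ P) (h : IsDeltaConst Δ P a b) (hrs : r * a - s * b ∈ P) :
    IsDeltaConst Δ P s r := by
  intro δ hδ
  have h1 := h δ hδ
  have h2 := hPΔ δ hδ _ hrs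
  have h3 : b * (b * (δ s * r - s * δ r)) ∈ P := by
    rw [← Ideal.Quotient.eq_zero_iff_mem] at h1 h2 hrs ⊢
    simp only [map_sub, map_mul, Derivation.leibniz, smul_eq_mul, map_add] at h1 h2 hrs ⊢
    linear_combination
      (-(Ideal.Quotient.mk P b) * (Ideal.Quotient.mk P r)) * h2
        + (Ideal.Quotient.mk P r) ^ 2 * h1
        + ((Ideal.Quotient.mk P r) * (Ideal.Quotient.mk P (δ b))
          + (Ideal.Quotient.mk P b) * (Ideal.Quotient.mk P (δ r))) * hrs
  exact ((hP.mem_or_mem ((hP.mem_or_mem h3).resolve_left hb))).resolve_left hb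

/-- The fractions killed by `Δ` are regular at every ideal whose `Δ`-core is `P`. -/
theorem IsDeltaConst.exists_notMem_mul_sub_mul_mem {M : Ideal R} (hP : P.IsPrime)
    (hM : deltaCore k R Δ M = P) {a b : R} (hb : b ∉ P) (h : IsDeltaConst Δ P a b) :
    ∃ r s : R, r ∉ M ∧ r * a - s * b ∈ P := by
  have hPΔ : IsDeltaIdeal k R Δ P := hM ▸ deltaCore_isDeltaIdeal M
  let I : Ideal R := ((Ideal.span {b} ⊔ P).restrictScalars R).comap (LinearMap.mulLeft R a)
  have mem_I (r : R) : r ∈ I ↔ ∃ s, r * a - s * b ∈ P := by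
    change a * r ∈ Ideal.span {b} ⊔ P ↔ _
    rw [Ideal.mem_span_singleton_sup]
    constructor
    · rintro ⟨s, p, hp, hsp⟩
      exact ⟨s, by rwa [mul_comm, ← hsp, add_sub_cancel_left]⟩
    · rintro ⟨s, hs⟩
      exact ⟨s, _, hs, by ring⟩
  have hI : IsDeltaIdeal k R Δ I := by
    intro δ hδ r hr
    obtain ⟨s, hs⟩ := (mem_I r).1 hr
    refine (mem_I _).2 ⟨δ s, ?_⟩
    have h1 := h δ hδ
    have h2 := hPΔ δ hδ _ hs
    have h3 : b * (δ r * a - δ s * b) ∈ P := by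
      rw [← Ideal.Quotient.eq_zero_iff_mem] at h1 h2 hs ⊢
      simp only [map_sub, map_mul, Derivation.leibniz, smul_eq_mul, map_add] at h1 h2 hs ⊢
      linear_combination
        (Ideal.Quotient.mk P b) * h2 - (Ideal.Quotient.mk P r) * h1
          - (Ideal.Quotient.mk P (δ b)) * hs
    exact (hP.mem_or_mem h3).resolve_left hb
  have hIM : ¬ I ≤ M := fun hle =>
    hb (hM ▸ le_deltaCore hI hle ((mem_I b).2 ⟨a, by simp [mul_comm]⟩))
  obtain ⟨r, hr, hrM⟩ := SetLike.not_le_iff_exists.1 hIM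
  obtain ⟨s, hs⟩ := (mem_I r).1 hr
  exact ⟨r, s, hrM, hs⟩

/-- The canonical map from `R` to the residue field at `P`. -/
noncomputable def toFractionRingQuotient (k : Type*) {R : Type*} [Field k] [CommRing R]
    [Algebra k R] (P : Ideal R) :
    R →ₐ[k] FractionRing (R ⧸ P) :=
  (IsScalarTower.toAlgHom k (R ⧸ P) (FractionRing (R ⧸ P))).comp (Ideal.Quotient.mkₐ k P)

theorem toFractionRingQuotient_eq_zero_iff [P.IsPrime] {x : R} :
    toFractionRingQuotient k P x = 0 ↔ x ∈ P := by
  change algebraMap (R ⧸ P) (FractionRing (R ⧸ P)) (Ideal.Quotient.mk P x) = 0 ↔ _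
  rw [FaithfulSMul.algebraMap_eq_zero_iff, Ideal.Quotient.eq_zero_iff_mem]

theorem IsDeltaPrimitive.isDeltaRational (hrank : Module.rank k R < Cardinal.mk k)
    (hP : P.IsPrime) (h : IsDeltaPrimitive k R Δ P) : IsDeltaRational k R Δ P hP := by
  obtain ⟨M, hMmax, hM⟩ := h
  intro a b hb hab
  have hab : IsDeltaConst Δ P a b := hab
  have hPΔ : IsDeltaIdeal k R Δ P := hM ▸ deltaCore_isDeltaIdeal M
  have hPM : P ≤ M := hM ▸ deltaCore_le M
  obtain ⟨r, s, hr, hrs⟩ := hab.exists_notMem_mul_sub_mul_mem hP hM hb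
  have hsr : IsDeltaConst Δ P s r := IsDeltaConst.of_mul_sub_mul_mem hP hPΔ hb hab hrs
  let π := toFractionRingQuotient k P
  have hrP : π r ≠ 0 := fun h => hr (hPM (toFractionRingQuotient_eq_zero_iff.1 h))
  have hbP : π b ≠ 0 := fun h => hb (toFractionRingQuotient_eq_zero_iff.1 h)
  let _ : Field (R ⧸ M) := Ideal.Quotient.field M
  have halg : Algebra.IsAlgebraic k (R ⧸ M) := by
    refine isAlgebraic_of_rank_lt_mk (lt_of_le_of_lt ?_ hrank)
    exact LinearMap.rank_le_of_surjective (Ideal.Quotient.mkₐ k M).toLinearMap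
      (Ideal.Quotient.mkₐ_surjective k M)
  let φ : R →ₐ[k] R ⧸ M := Ideal.Quotient.mkₐ k M
  have φ_eq_zero (x : R) : φ x = 0 ↔ x ∈ M := Ideal.Quotient.eq_zero_iff_mem
  obtain ⟨f, hf, hfx⟩ := halg.isAlgebraic (φ s / φ r)
  have hFM : homogeneousEval f s r ∈ M := by
    rw [← φ_eq_zero, map_homogeneousEval φ f s (mt (φ_eq_zero r).1 hr), hfx, mul_zero]
  have hFP : homogeneousEval f s r ∈ P := by
    by_contra hFP
    obtain ⟨r', s', hr', hrs'⟩ :=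
      (hsr.homogeneousEval f).symm.exists_notMem_mul_sub_mul_mem hP hM hFP
    have h1 := add_mem (hPM hrs') (M.mul_mem_left s' hFM)
    rw [sub_add_cancel] at h1
    exact hr (hMmax.isPrime.mem_of_pow_mem _ ((hMmax.isPrime.mem_or_mem h1).resolve_left hr'))
  have hzero := toFractionRingQuotient_eq_zero_iff (k := k).2 hFP
  rw [map_homogeneousEval _ f s hrP] at hzero
  have hdiv : π a / π b = π s / π r := by
    have := toFractionRingQuotient_eq_zero_iff (k := k).2 hrs
    rw [map_sub, map_mul, map_mul, sub_eq_zero] at this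
    rw [div_eq_div_iff hbP hrP, mul_comm]
    exact this
  refine ⟨f, hf, ?_⟩
  change Polynomial.aeval (π a / π b) f = 0
  rw [hdiv]
  exact (mul_eq_zero.1 hzero).resolve_left (pow_ne_zero _ hrP)

end DeltaConstants

section WronskianClosure

variable {k R : Type u} [Field k] [CommRing R] [Algebra k R]

/-- The finite stages of the closure of a set `B` under the operations
`(v, w) ↦ v * δ w - δ v * w` with `δ ∈ Δ`. -/
def wronskianStage (Δ : Set (Derivation k R R)) (B : Set R) : ℕ → Set R
  | 0 => B
  | n + 1 => wronskianStage Δ B n ∪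
      Set.range fun p : wronskianStage Δ B n × wronskianStage Δ B n × Δ =>
        (p.1 : R) * p.2.2.1 p.2.1 - p.2.2.1 p.1 * p.2.1

/-- The closure of a set `B` under the operations `(v, w) ↦ v * δ w - δ v * w` with `δ ∈ Δ`. -/
def wronskianClosure (Δ : Set (Derivation k R R)) (B : Set R) : Set R :=
  ⋃ n : ULift.{u} ℕ, wronskianStage Δ B n.down

variable {Δ : Set (Derivation k R R)} {B : Set R}

theorem wronskianStage_mono : Monotone (wronskianStage Δ B) :=
  monotone_nat_of_le_succ fun _ => Set.subset_union_left

theorem subset_wronskianClosure : B ⊆ wronskianClosure Δ B :=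
  Set.subset_iUnion (fun n : ULift.{u} ℕ => wronskianStage Δ B n.down) ⟨0⟩

theorem wronskian_mem_wronskianClosure {δ : Derivation k R R} (hδ : δ ∈ Δ) {v w : R}
    (hv : v ∈ wronskianClosure Δ B) (hw : w ∈ wronskianClosure Δ B) :
    v * δ w - δ v * w ∈ wronskianClosure Δ B := by
  obtain ⟨⟨m⟩, hm⟩ := Set.mem_iUnion.1 hv
  obtain ⟨⟨n⟩, hn⟩ := Set.mem_iUnion.1 hw
  refine Set.mem_iUnion.2 ⟨⟨max m n + 1⟩, Or.inr ?_⟩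
  exact ⟨(⟨v, wronskianStage_mono (le_max_left m n) hm⟩,
    ⟨w, wronskianStage_mono (le_max_right m n) hn⟩, ⟨δ, hδ⟩), rfl⟩

theorem mk_wronskianClosure_le {μ : Cardinal.{u}} (hμ : Cardinal.aleph0 ≤ μ)
    (hB : Cardinal.mk B ≤ μ) (hΔ : Cardinal.mk Δ ≤ μ) :
    Cardinal.mk (wronskianClosure Δ B) ≤ μ := by
  have hstage (n : ℕ) : Cardinal.mk (wronskianStage Δ B n) ≤ μ := by
    induction n with
    | zero => exact hB
    | succ n ih =>
      refine (Cardinal.mk_union_le _ _).trans (Cardinal.add_le_of_le hμ ih ?_)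
      refine Cardinal.mk_range_le.trans ?_
      simp only [Cardinal.mk_prod, Cardinal.lift_id]
      exact Cardinal.mul_le_of_le hμ ih (Cardinal.mul_le_of_le hμ ih hΔ)
  refine (Cardinal.mk_iUnion_le _).trans (Cardinal.mul_le_of_le hμ ?_ ?_)
  · simpa using hμ
  · exact ciSup_le' fun n => hstage n.down

/-- If `P` is `Δ`-rational, a `Δ`-prime ideal containing `P` and a linear combination, outside
`P`, of elements of a set stable under Wronskians also contains an element of this set
outside `P`. -/
theorem IsDeltaRational.exists_mem_wronskianClosure {P Q : Ideal R} {hP : P.IsPrime}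
    (hrat : IsDeltaRational k R Δ P hP)
    (hQ : IsDeltaPrime k R Δ Q) (hPQ : P ≤ Q) (n : ℕ) (c : Fin n → k) (w : Fin n → R)
    (hw : ∀ i, w i ∈ wronskianClosure Δ B) (hmem : ∑ i, c i • w i ∈ Q)
    (hnot : ∑ i, c i • w i ∉ P) : ∃ d ∈ wronskianClosure Δ B, d ∈ Q ∧ d ∉ P := by
  induction n with
  | zero => simp at hnot
  | succ n ih =>
    by_cases h0 : w 0 ∈ P
    · have h0' : c 0 • w 0 ∈ P := (P.restrictScalars k).smul_mem _ h0
      rw [Fin.sum_univ_succ] at hmem hnot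
      exact ih (fun i => c i.succ) (fun i => w i.succ) (fun i => hw _)
        ((Q.add_mem_iff_right (hPQ h0')).1 hmem) fun h => hnot (P.add_mem h0' h)
    set v := ∑ i, c i • w i with hv
    by_cases hconst : ∀ δ ∈ Δ, δ v * w 0 - v * δ (w 0) ∈ P
    · refine ⟨w 0, hw 0, ?_, h0⟩
      let π := toFractionRingQuotient k P
      have hv0 : π v ≠ 0 := mt toFractionRingQuotient_eq_zero_iff.1 hnot
      have hw0 : π (w 0) ≠ 0 := mt toFractionRingQuotient_eq_zero_iff.1 h0
      have halg : IsAlgebraic k (π v / π (w 0)) := hrat v (w 0) h0 hconst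
      obtain ⟨f, hf, hfx⟩ := halg.exists_nonzero_coeff_and_aeval_eq_zero
        (mem_nonZeroDivisors_of_ne_zero (div_ne_zero hv0 hw0))
      refine mem_of_homogeneousEval_mem hQ.1 hf (hPQ ?_) hmem
      rw [← toFractionRingQuotient_eq_zero_iff (k := k), map_homogeneousEval _ f v hw0]
      exact mul_eq_zero_of_right _ hfx
    · push Not at hconst
      obtain ⟨δ, hδ, hδv⟩ := hconst
      have heq : ∑ i : Fin n, c i.succ • (w 0 * δ (w i.succ) - δ (w 0) * w i.succ) =
          δ v * w 0 - v * δ (w 0) := by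
        have h1 : δ v * w 0 - v * δ (w 0) =
            ∑ i, c i • (w 0 * δ (w i) - δ (w 0) * w i) := by
          simp only [hv, map_sum, Finset.sum_mul, ← Finset.sum_sub_distrib, Derivation.map_smul]
          refine Finset.sum_congr rfl fun i _ => ?_
          rw [smul_mul_assoc, smul_mul_assoc, ← smul_sub]
          ring_nf
        rw [h1, Fin.sum_univ_succ, mul_comm (w 0), sub_self, smul_zero, zero_add]
      refine ih (fun i => c i.succ) (fun i => w 0 * δ (w i.succ) - δ (w 0) * w i.succ)
        (fun i => wronskian_mem_wronskianClosure hδ (hw _) (hw _)) ?_ ?_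
      · rw [heq]
        exact sub_mem (Q.mul_mem_right _ (hQ.2 δ hδ _ hmem)) (Q.mul_mem_right _ hmem)
      · rwa [heq]

end WronskianClosure

section Separability

variable {k R : Type u} [Field k] [CommRing R] [Algebra k R]
  {Δ : Set (Derivation k R R)} {P : Ideal R}

theorem Ideal.IsPrime.isMaximal_of_rank_lt_aleph0 (hrank : Module.rank k R < Cardinal.aleph0)
    (hP : P.IsPrime) : P.IsMaximal := by
  have : Module.Finite k R := Module.rank_lt_aleph0_iff.1 hrank
  exact Ideal.Quotient.maximal_of_isField P
    (isField_of_isIntegral_of_isField' (R := k) (Field.toIsField k))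

theorem IsDeltaRational.deltaSeparable [CharZero k] [IsNoetherianRing R]
    (hrank : Module.rank k R < Cardinal.mk k) (hΔ : Cardinal.mk Δ < Cardinal.mk k)
    {hP : P.IsPrime} (hrat : IsDeltaRational k R Δ P hP) :
    DeltaSeparable k R Δ (Cardinal.mk k) P := by
  rcases le_or_gt (Cardinal.mk k) Cardinal.aleph0 with hk | hk
  · refine ⟨∅, by simp, by simpa using Cardinal.mk_ne_zero k |>.bot_lt, fun Q hQ hPQ => ?_⟩
    have hmax : P.IsMaximal := hP.isMaximal_of_rank_lt_aleph0 (hrank.trans_le hk)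
    exact absurd (hmax.eq_of_le hQ.1.ne_top hPQ.le) hPQ.ne
  let b := Module.Basis.ofVectorSpace k R
  let B : Set R := Set.range b
  let μ := max Cardinal.aleph0 (max (Module.rank k R) (Cardinal.mk Δ))
  have hμ : Cardinal.aleph0 ≤ μ := le_max_left _ _
  have hμk : μ < Cardinal.mk k := max_lt hk (max_lt hrank hΔ)
  have hB : Cardinal.mk B ≤ μ := by
    refine Cardinal.mk_range_le.trans ?_
    rw [b.mk_eq_rank'']
    exact (le_max_left _ _).trans (le_max_right _ _)
  have hD : Cardinal.mk (wronskianClosure Δ B) ≤ μ :=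
    mk_wronskianClosure_le hμ hB ((le_max_right _ _).trans (le_max_right _ _))
  refine ⟨⋃ d : {d : wronskianClosure Δ B // d.1 ∉ P}, deltaMinimalOver Δ P d.1.1, ?_, ?_, ?_⟩
  · intro Q hQ
    obtain ⟨d, hd⟩ := Set.mem_iUnion.1 hQ
    exact deltaMinimalOver_spec d.2 Q hd
  · refine lt_of_le_of_lt ?_ hμk
    refine (Cardinal.mk_iUnion_le _).trans (Cardinal.mul_le_of_le hμ ?_ ?_)
    · exact (Cardinal.mk_subtype_le _).trans hD
    · exact ciSup_le' fun d => ((deltaMinimalOver_finite P d.1.1).lt_aleph0.le).trans hμ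
  · intro Q hQ hPQ
    obtain ⟨v, hvQ, hvP⟩ := (SetLike.lt_iff_le_and_exists.1 hPQ).2
    obtain ⟨n, c, g, hg⟩ := Submodule.mem_span_set'.1
      (show v ∈ Submodule.span k B from b.span_eq ▸ Submodule.mem_top)
    obtain ⟨d, hd, hdQ, hdP⟩ := hrat.exists_mem_wronskianClosure (B := B) hQ hPQ.le n c
      (fun i => g i) (fun i => subset_wronskianClosure (g i).2) (hg ▸ hvQ) (hg ▸ hvP)
    obtain ⟨Q', hQ', hle⟩ := exists_deltaMinimalOver_le hQ hPQ.le hdQ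
    exact ⟨Q', Set.mem_iUnion.2 ⟨⟨⟨d, hd⟩, hdP⟩, hQ'⟩, hle⟩

theorem Submonoid.mk_closure_le_max {M : Type u} [Monoid M] (s : Set M) :
    Cardinal.mk (Submonoid.closure s) ≤ max Cardinal.aleph0 (Cardinal.mk s) := by
  rw [Submonoid.closure_eq_mrange]
  exact Cardinal.mk_range_le.trans (Cardinal.mk_list_le_max s)

theorem Localization.rank_le (T : Submonoid R) :
    Module.rank k (Localization T) ≤ Module.rank k R * Cardinal.mk T := by
  let b := Module.Basis.ofVectorSpace k R
  let g : _ × T → Localization T := fun p => Localization.mk (b p.1) p.2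
  have hspan : Submodule.span k (Set.range g) = ⊤ := by
    refine eq_top_iff.2 fun x _ => ?_
    induction x with | _ y =>
    obtain ⟨r, t⟩ := y
    have hr : r ∈ Submodule.span k (Set.range b) := b.span_eq ▸ Submodule.mem_top
    induction hr using Submodule.span_induction with
    | mem r hr =>
      obtain ⟨i, rfl⟩ := hr
      exact Submodule.subset_span ⟨(i, t), rfl⟩
    | zero => simp [Localization.mk_zero]
    | add r s _ _ hr hs =>
      have := add_mem (hr trivial) (hs trivial)
      rwa [Localization.add_mk_self] at this
    | smul c r _ hr =>
      have := Submodule.smul_mem _ c (hr trivial)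
      rwa [Localization.smul_mk] at this
  rw [← rank_top, ← hspan]
  refine (rank_span_le _).trans (Cardinal.mk_range_le.trans ?_)
  rw [Cardinal.mk_prod, Cardinal.lift_id, Cardinal.lift_id, b.mk_eq_rank'']

/-- Over a large enough field, fewer than `#k` elements outside a prime ideal `P` can be avoided
simultaneously by a maximal ideal containing `P`. -/
theorem exists_isMaximal_disjoint (hP : P.IsPrime) (hk : Cardinal.aleph0 < Cardinal.mk k)
    (hrank : Module.rank k R < Cardinal.mk k) (s : Set R) (hs : Cardinal.mk s < Cardinal.mk k)
    (hsP : Disjoint s P) : ∃ M : Ideal R, M.IsMaximal ∧ P ≤ M ∧ Disjoint s M := by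
  let T := Submonoid.closure s
  have hT : Disjoint (T : Set R) P := by
    have : T ≤ P.primeCompl :=
      Submonoid.closure_le.2 fun x hx => Set.disjoint_left.1 hsP hx
    exact Set.disjoint_left.2 fun x hx => this hx
  obtain ⟨N, hN, hPN⟩ := Ideal.exists_le_maximal _
    ((IsLocalization.map_algebraMap_ne_top_iff_disjoint T (Localization T) P).2 hT)
  let _ : Field (Localization T ⧸ N) := Ideal.Quotient.field N
  have halg : Algebra.IsAlgebraic k (Localization T ⧸ N) := by
    refine isAlgebraic_of_rank_lt_mk (lt_of_le_of_lt ?_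
      (Cardinal.mul_lt_of_lt hk.le hrank
        ((Submonoid.mk_closure_le_max s).trans_lt (max_lt hk hs))))
    exact (LinearMap.rank_le_of_surjective (Ideal.Quotient.mkₐ k N).toLinearMap
      (Ideal.Quotient.mkₐ_surjective k N)).trans (Localization.rank_le T)
  have hint : Algebra.IsIntegral k (Localization T ⧸ N) := halg.isIntegral
  have hint' : Algebra.IsIntegral R (Localization T ⧸ N) := Algebra.IsIntegral.tower_top k
  have hmax := Ideal.isMaximal_comap_of_isIntegral_of_isMaximal (R := R)
    (⊥ : Ideal (Localization T ⧸ N))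
  have hmem (x : R) : x ∈ (⊥ : Ideal (Localization T ⧸ N)).comap
      (algebraMap R (Localization T ⧸ N)) ↔ algebraMap R (Localization T) x ∈ N := by
    rw [Ideal.mem_comap, Ideal.mem_bot]
    exact Ideal.Quotient.eq_zero_iff_mem
  refine ⟨_, hmax, fun x hx => (hmem x).2 (hPN (Ideal.mem_map_of_mem _ hx)), ?_⟩
  refine Set.disjoint_left.2 fun x hx hxM => hN.ne_top ?_
  exact Ideal.eq_top_of_isUnit_mem _ ((hmem x).1 hxM)
    (IsLocalization.map_units (Localization T) ⟨x, Submonoid.subset_closure hx⟩)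

theorem DeltaSeparable.isDeltaPrimitive [CharZero k] (hrank : Module.rank k R < Cardinal.mk k)
    (hP : IsDeltaPrime k R Δ P) (h : DeltaSeparable k R Δ (Cardinal.mk k) P) :
    IsDeltaPrimitive k R Δ P := by
  rcases le_or_gt (Cardinal.mk k) Cardinal.aleph0 with hk | hk
  · exact ⟨P, hP.1.isMaximal_of_rank_lt_aleph0 (hrank.trans_le hk),
      le_antisymm (deltaCore_le P) (le_deltaCore hP.2 le_rfl)⟩
  obtain ⟨Λ, hΛ, hcard, hsep⟩ := h
  have hch : ∀ Q : Λ, ∃ f ∈ Q.1, f ∉ P := fun Q =>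
    (SetLike.lt_iff_le_and_exists.1 (hΛ Q.1 Q.2).2).2
  choose f hfQ hfP using hch
  obtain ⟨M, hM, hPM, hfM⟩ := exists_isMaximal_disjoint hP.1 hk hrank (Set.range f)
    (Cardinal.mk_range_le.trans_lt hcard)
    (Set.disjoint_left.2 fun x hx => by obtain ⟨Q, rfl⟩ := hx; exact hfP Q)
  refine ⟨M, hM, ?_⟩
  by_contra hne
  obtain ⟨Q, hQ, hle⟩ := hsep (deltaCore k R Δ M)
    ⟨deltaCore_isPrime hM.isPrime, deltaCore_isDeltaIdeal M⟩
    (lt_of_le_of_ne (le_deltaCore hP.2 hPM) (Ne.symm hne))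
  exact Set.disjoint_left.1 hfM ⟨⟨Q, hQ⟩, rfl⟩ (deltaCore_le M (hle (hfQ ⟨Q, hQ⟩)))

/-- Over a large enough field, the Dixmier–Moeglin equivalence compares two notions of
separability, which depend only on the poset of `Δ`-prime ideals. -/
theorem deltaDME_iff_deltaSeparable [CharZero k] [IsNoetherianRing R]
    (hrank : Module.rank k R < Cardinal.mk k) (hΔ : Cardinal.mk Δ < Cardinal.mk k) :
    DeltaDME k R Δ ↔ ∀ P : {P : Ideal R // IsDeltaPrime k R Δ P},
      (DeltaSeparable k R Δ Cardinal.aleph0 P.1 ↔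
        DeltaSeparable k R Δ (Cardinal.mk k) P.1) := by
  have prim_rat (P : Ideal R) (hP : IsDeltaPrime k R Δ P) (h : IsDeltaPrimitive k R Δ P) :
      IsDeltaRational k R Δ P hP.1 := h.isDeltaRational hrank hP.1
  have rat_sep (P : Ideal R) (hP : IsDeltaPrime k R Δ P) (h : IsDeltaRational k R Δ P hP.1) :
      DeltaSeparable k R Δ (Cardinal.mk k) P := h.deltaSeparable hrank hΔ
  have sep_prim (P : Ideal R) (hP : IsDeltaPrime k R Δ P)
      (h : DeltaSeparable k R Δ (Cardinal.mk k) P) : IsDeltaPrimitive k R Δ P :=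
    h.isDeltaPrimitive hrank hP
  constructor
  · intro h P
    have hP := P.2
    rw [← isLocallyClosed_iff_deltaSeparable ⟨P.1, hP.1⟩ hP.2, (h ⟨P.1, hP.1⟩ hP.2).1]
    exact ⟨fun h => rat_sep _ hP (prim_rat _ hP h), sep_prim _ hP⟩
  · intro h P hPΔ
    have hP : IsDeltaPrime k R Δ P.asIdeal := ⟨P.isPrime, hPΔ⟩
    rw [isLocallyClosed_iff_deltaSeparable P hPΔ, h ⟨P.asIdeal, hP⟩]
    exact ⟨⟨sep_prim _ hP, fun h => rat_sep _ hP (prim_rat _ hP h)⟩,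
      prim_rat _ hP, fun h => sep_prim _ hP (rat_sep _ hP h)⟩

end Separability

section OrderIso

variable {k R S : Type u} [Field k] [CommRing R] [Algebra k R] [CommRing S] [Algebra k S]
  {ΔR : Set (Derivation k R R)} {ΔS : Set (Derivation k S S)}

theorem DeltaSeparable.map_orderIso
    (e : {P : Ideal R // IsDeltaPrime k R ΔR P} ≃o {Q : Ideal S // IsDeltaPrime k S ΔS Q})
    {κ : Cardinal.{u}} {P : {P : Ideal R // IsDeltaPrime k R ΔR P}}
    (h : DeltaSeparable k R ΔR κ P.1) : DeltaSeparable k S ΔS κ (e P).1 := by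
  obtain ⟨Λ, hΛ, hcard, hsep⟩ := h
  refine ⟨Set.range fun Q : Λ => (e ⟨Q.1, (hΛ Q.1 Q.2).1⟩).1, ?_,
    Cardinal.mk_range_le.trans_lt hcard, ?_⟩
  · rintro _ ⟨Q, rfl⟩
    refine ⟨(e _).2, ?_⟩
    exact e.lt_iff_lt.2 (show P < ⟨Q.1, (hΛ Q.1 Q.2).1⟩ from (hΛ Q.1 Q.2).2)
  · intro Q hQ hPQ
    have hlt : P < e.symm ⟨Q, hQ⟩ := e.lt_symm_apply.2 hPQ
    obtain ⟨Q', hQ', hle⟩ := hsep _ (e.symm ⟨Q, hQ⟩).2 hlt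
    exact ⟨_, ⟨⟨Q', hQ'⟩, rfl⟩,
      e.le_symm_apply.1 (show ⟨Q', (hΛ Q' hQ').1⟩ ≤ e.symm ⟨Q, hQ⟩ from hle)⟩

theorem deltaSeparable_orderIso_iff
    (e : {P : Ideal R // IsDeltaPrime k R ΔR P} ≃o {Q : Ideal S // IsDeltaPrime k S ΔS Q})
    (κ : Cardinal.{u}) (P : {P : Ideal R // IsDeltaPrime k R ΔR P}) :
    DeltaSeparable k S ΔS κ (e P).1 ↔ DeltaSeparable k R ΔR κ P.1 :=
  ⟨fun h => by simpa using h.map_orderIso e.symm, fun h => h.map_orderIso e⟩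

variable (k R) in
/-- `Δ`-prime ideals, as ideals and as points of the prime spectrum. -/
def deltaSpecEquiv (Δ : Set (Derivation k R R)) :
    DeltaSpec k R Δ ≃ {P : Ideal R // IsDeltaPrime k R Δ P} where
  toFun P := ⟨P.1.asIdeal, P.1.isPrime, P.2⟩
  invFun P := ⟨⟨P.1, P.2.1⟩, P.2.2⟩

theorem specializes_deltaSpec_iff (P Q : DeltaSpec k R ΔR) :
    P ⤳ Q ↔ P.1.asIdeal ≤ Q.1.asIdeal := by
  rw [subtype_specializes_iff, ← PrimeSpectrum.le_iff_specializes]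
  rfl

end OrderIso

/-- If the posets of `Δ`-prime ideals of `R` and `S` are order isomorphic, then `R` satisfies the
`Δ_R`-Dixmier–Moeglin equivalence iff `S` satisfies the `Δ_S`-one; in particular this holds when
`Δ_R`-spec `R` and `Δ_S`-spec `S` are homeomorphic. -/
theorem deltaDME_iff_of_orderIso (k R S : Type u) [Field k] [CharZero k]
    [CommRing R] [Algebra k R] [IsNoetherianRing R]
    [CommRing S] [Algebra k S] [IsNoetherianRing S]
    (hrankR : Module.rank k R < Cardinal.mk k) (hrankS : Module.rank k S < Cardinal.mk k)
    (ΔR : Set (Derivation k R R)) (ΔS : Set (Derivation k S S))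
    (hΔR : Cardinal.mk ΔR < Cardinal.mk k) (hΔS : Cardinal.mk ΔS < Cardinal.mk k) :
    ((∃ e : {P : Ideal R // IsDeltaPrime k R ΔR P} ≃ {Q : Ideal S // IsDeltaPrime k S ΔS Q},
        ∀ P₁ P₂, P₁.1 ≤ P₂.1 ↔ (e P₁).1 ≤ (e P₂).1) →
      (DeltaDME k R ΔR ↔ DeltaDME k S ΔS)) ∧
    (Nonempty (DeltaSpec k R ΔR ≃ₜ DeltaSpec k S ΔS) →
      (DeltaDME k R ΔR ↔ DeltaDME k S ΔS)) := by
  have main (e : {P : Ideal R // IsDeltaPrime k R ΔR P} ≃o {Q : Ideal S // IsDeltaPrime k S ΔS Q}) :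
      DeltaDME k R ΔR ↔ DeltaDME k S ΔS := by
    rw [deltaDME_iff_deltaSeparable hrankR hΔR, deltaDME_iff_deltaSeparable hrankS hΔS,
      ← e.toEquiv.forall_congr_right]
    refine forall_congr' fun P => ?_
    exact iff_congr (deltaSeparable_orderIso_iff e _ P).symm
      (deltaSeparable_orderIso_iff e _ P).symm
  refine ⟨fun ⟨e, he⟩ => main ⟨e, fun {P₁ P₂} => (he P₁ P₂).symm⟩, fun ⟨h⟩ => ?_⟩
  refine main ⟨((deltaSpecEquiv k R ΔR).symm.trans h.toEquiv).trans (deltaSpecEquiv k S ΔS),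
    fun {P₁ P₂} => ?_⟩
  exact (specializes_deltaSpec_iff _ _).symm.trans
    (h.isInducing.specializes_iff.trans (specializes_deltaSpec_iff _ _))
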